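/- Let ε > 0, let α ∈ 𝒦, and let γ ∈ ℝ. Then for Lebesgue almost all β ∈ ℝ, for every δ ∈ ℝ there are infinitely many positive integers n with n · ‖nα − γ‖ · ‖nβ − δ‖ < (log log n)^(3+ε) / log n. -/

import Mathlib

open Real MeasureTheory Set

/-- Distance from `x` to the nearest integer. -/
noncomputable def nint (x : ℝ) : ℝ := ⨅ n : ℤ, |x - n|

/-- The set of badly approximable numbers. -/
def Bad : Set ℝ := {α : ℝ | ∃ c > 0, ∀ n : ℕ, 1 ≤ n → c ≤ n * nint (n * α)}

/-- The set of `δ`-inhomogeneously badly approximable numbers. -/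
def BadShift (δ : ℝ) : Set ℝ := {β : ℝ | ∃ c > 0, ∀ n : ℕ, 1 ≤ n → c ≤ n * nint (n * β - δ)}

/-- The set `ℬ = {(β, δ) : β ∈ Bad ∩ Bad(δ)}`. -/
def calB : Set (ℝ × ℝ) := {p : ℝ × ℝ | p.1 ∈ Bad ∧ p.1 ∈ BadShift p.2}

/-- The `k`-th continuant `q_k(α)` (denominator of the `k`-th convergent) of the
continued fraction expansion of `α`. -/
noncomputable def contDen (α : ℝ) (k : ℕ) : ℝ := (GenContFract.of α).dens k

/-- `Λ(α) = sup_{k ≥ 1} (log q_k(α)) / k`. -/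
noncomputable def Lam (α : ℝ) : ℝ := ⨆ k : ℕ+, Real.log (contDen α k) / k

/-- Membership in the set `𝒦` of irrational numbers with `Λ(α) < ∞`. -/
def memK (α : ℝ) : Prop :=
  Irrational α ∧ BddAbove (Set.range fun k : ℕ+ => Real.log (contDen α k) / k)

/-- The Fourier transform `μ̂(ξ) = ∫ e^{-2πiξx} dμ(x)` of a measure `μ` on `ℝ`. -/
noncomputable def mFT (μ : Measure ℝ) (ξ : ℝ) : ℂ :=
  ∫ x, Complex.exp (-(2 * Real.pi * ξ * x : ℝ) * Complex.I) ∂μ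

/-- Dispersion of a (finite) set `A ⊆ [0,1)`: the largest gap between circularly
consecutive elements, where the gap between the largest and the smallest element
wraps around, i.e. equals `min A + 1 - max A`. -/
noncomputable def disp (A : Set ℝ) : ℝ :=
  sSup {d : ℝ |
    (∃ a ∈ A, ∃ b ∈ A, a < b ∧ (∀ x ∈ A, x ≤ a ∨ b ≤ x) ∧ d = b - a) ∨
    (∃ a ∈ A, ∃ b ∈ A, (∀ x ∈ A, b ≤ x ∧ x ≤ a) ∧ d = b + 1 - a)}

theorem nint_le_abs_sub (x : ℝ) (z : ℤ) : nint x ≤ |x - z| :=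
  ciInf_le ⟨0, by rintro _ ⟨n, rfl⟩; exact abs_nonneg _⟩ z

theorem nint_nonneg (x : ℝ) : 0 ≤ nint x :=
  le_ciInf fun _ => abs_nonneg _

/-- If the fractional parts of `x - t` and `y - t` are both less than `η`, then `x - y` is within
`η` of an integer. -/
theorem nint_sub_le_of_fract_lt {x y t η : ℝ} (hx : Int.fract (x - t) < η)
    (hy : Int.fract (y - t) < η) : nint (x - y) ≤ η := by
  refine (nint_le_abs_sub (x - y) (⌊x - t⌋ - ⌊y - t⌋)).trans ?_
  have hx' := Int.fract_nonneg (x - t)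
  have hy' := Int.fract_nonneg (y - t)
  unfold Int.fract at *
  push_cast
  rw [abs_le]
  constructor <;> linarith

/-- The points of `[a, b]` whose dilates by `m 0, …, m (M - 1)` all miss the arc `[t, t + η)`
modulo `1` form a set of exponentially small measure, provided `m` grows fast enough. -/
theorem volume_forall_le_fract_le {η : ℝ} (t : ℝ) (hη1 : η ≤ 1) (M : ℕ) :
    ∀ m : ℕ → ℝ, (∀ i, 0 < m i) → (∀ i, 4 * m i ≤ η * m (i + 1)) → ∀ a b : ℝ, a ≤ b →
      volume {x ∈ Icc a b | ∀ i < M, η ≤ Int.fract (m i * x - t)} ≤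
        ENNReal.ofReal ((1 - η / 2) ^ M * (b - a + 2 / m 0)) := by
  induction M with
  | zero =>
    intro m hm _ a b _
    simp only [not_lt_zero, IsEmpty.forall_iff, implies_true, and_true, ofPred_mem_eq,
      Real.volume_Icc, pow_zero, one_mul]
    have := hm 0
    exact ENNReal.ofReal_le_ofReal (le_add_of_nonneg_right (by positivity))
  | succ M ih =>
    intro m hm hgrow a b hab
    have hm0 := hm 0
    have hm1 := hm 1
    set I : Finset ℤ := Finset.Icc ⌊m 0 * a - t⌋ ⌊m 0 * b - t⌋ with hI
    set A : ℤ → Set ℝ := fun k => {x ∈ Icc ((k + t + η) / m 0) ((k + t + 1) / m 0) |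
      ∀ i < M, η ≤ Int.fract (m (i + 1) * x - t)}
    have hsub : {x ∈ Icc a b | ∀ i < M + 1, η ≤ Int.fract (m i * x - t)} ⊆ ⋃ k ∈ I, A k := by
      rintro x ⟨⟨hax, hxb⟩, hx⟩
      simp only [mem_iUnion]
      have h0 := hx 0 (Nat.succ_pos _)
      have h1 := Int.fract_lt_one (m 0 * x - t)
      unfold Int.fract at h0 h1
      refine ⟨⌊m 0 * x - t⌋, Finset.mem_Icc.2 ⟨?_, ?_⟩, ⟨?_, ?_⟩, fun i hi => hx (i + 1) (by lia)⟩
      · gcongr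
      · gcongr
      · rw [div_le_iff₀ hm0]; linarith
      · rw [le_div_iff₀ hm0]; linarith
    have hAle : ∀ k ∈ I, volume (A k) ≤
        ENNReal.ofReal ((1 - η / 2) ^ M * ((1 - η / 2) / m 0)) := by
      intro k _
      refine (ih (fun i => m (i + 1)) (fun i => hm _) (fun i => hgrow _) _ _ ?_).trans ?_
      · gcongr
      · refine ENNReal.ofReal_le_ofReal (mul_le_mul_of_nonneg_left ?_ (pow_nonneg (by linarith) _))
        have h2 : 2 / m 1 ≤ η / 2 / m 0 := by
          rw [div_le_div_iff₀ hm1 hm0]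
          have := hgrow 0
          simp only [zero_add] at this
          linarith
        calc (k + t + 1) / m 0 - (k + t + η) / m 0 + 2 / m 1
            ≤ (k + t + 1) / m 0 - (k + t + η) / m 0 + η / 2 / m 0 := by gcongr
          _ = (1 - η / 2) / m 0 := by ring
    have hcard : (I.card : ℝ) ≤ m 0 * (b - a) + 2 := by
      have hfl : ⌊m 0 * a - t⌋ ≤ ⌊m 0 * b - t⌋ := by gcongr
      have : (I.card : ℤ) = ⌊m 0 * b - t⌋ + 1 - ⌊m 0 * a - t⌋ := by
        rw [hI, Int.card_Icc, Int.toNat_of_nonneg (by lia)]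
      have hc : (I.card : ℝ) = ⌊m 0 * b - t⌋ + 1 - ⌊m 0 * a - t⌋ := by exact_mod_cast this
      have h1 := Int.floor_le (m 0 * b - t)
      have h2 := Int.lt_floor_add_one (m 0 * a - t)
      rw [hc]; linarith
    have hc0 : 0 ≤ (1 - η / 2) ^ M * ((1 - η / 2) / m 0) :=
      mul_nonneg (pow_nonneg (by linarith) _) (div_nonneg (by linarith) hm0.le)
    calc volume {x ∈ Icc a b | ∀ i < M + 1, η ≤ Int.fract (m i * x - t)}
        ≤ volume (⋃ k ∈ I, A k) := measure_mono hsub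
      _ ≤ ∑ k ∈ I, volume (A k) := measure_biUnion_finset_le _ _
      _ ≤ I.card • ENNReal.ofReal ((1 - η / 2) ^ M * ((1 - η / 2) / m 0)) :=
          Finset.sum_le_card_nsmul _ _ _ hAle
      _ = ENNReal.ofReal (I.card * ((1 - η / 2) ^ M * ((1 - η / 2) / m 0))) := by
          rw [nsmul_eq_mul, ENNReal.ofReal_mul (Nat.cast_nonneg _), ENNReal.ofReal_natCast]
      _ ≤ ENNReal.ofReal ((1 - η / 2) ^ (M + 1) * (b - a + 2 / m 0)) := by
          refine ENNReal.ofReal_le_ofReal ((mul_le_mul_of_nonneg_right hcard hc0).trans_eq ?_)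
          rw [pow_succ]
          field_simp

/-- An inhomogeneous approximation obtained from a good rational approximation `p / q`. -/
theorem exists_nat_nint_sub_le {α : ℝ} {p : ℤ} {q : ℕ} (hq : 0 < q) (hpq : IsCoprime p (q : ℤ))
    (hα : |α - p / q| ≤ 1 / (q : ℝ) ^ 2) (γ : ℝ) :
    ∃ n : ℕ, q ≤ n ∧ n < 2 * q ∧ nint (n * α - γ) ≤ 3 / q := by
  obtain ⟨u, v, huv⟩ := hpq
  have hqz : (0 : ℤ) < q := by exact_mod_cast hq
  have hqr : (0 : ℝ) < q := by exact_mod_cast hq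
  set c : ℤ := ⌊q * γ⌋
  have hr0 := Int.emod_nonneg (u * c) hqz.ne'
  have hr1 := Int.emod_lt_of_pos (u * c) hqz
  have hn : ((q + (u * c % q).toNat : ℕ) : ℤ) = q + u * c % q := by
    rw [Nat.cast_add, Int.toNat_of_nonneg hr0]
  set n : ℕ := q + (u * c % q).toNat
  have hn2 : n < 2 * q := by lia
  refine ⟨n, by lia, hn2, ?_⟩
  set z : ℤ := p - u * c / q * p - v * c with hz
  have hkey : (n : ℤ) * p - c = q * z := by
    have h := Int.emod_add_mul_ediv (u * c) q
    rw [hn, hz]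
    linear_combination p * h + c * huv
  have hkey' : (n : ℝ) * p - c = q * z := by exact_mod_cast hkey
  have hsplit : n * α - γ - z = n * (α - p / q) + (c - q * γ) / q := by
    field_simp
    linear_combination hkey'
  have hn2' : (n : ℝ) ≤ 2 * q := by exact_mod_cast hn2.le
  have h1 : |n * (α - p / q)| ≤ 2 / q := by
    rw [abs_mul, Nat.abs_cast]
    calc (n : ℝ) * |α - p / q| ≤ 2 * q * (1 / (q : ℝ) ^ 2) := by gcongr
      _ = 2 / q := by field_simp
  have h2 : |(c - q * γ) / q| ≤ 1 / q := by
    rw [abs_div, abs_of_pos hqr]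
    gcongr
    have := Int.floor_le (q * γ)
    have := Int.lt_floor_add_one (q * γ)
    rw [abs_le]
    constructor <;> linarith
  calc nint (n * α - γ) ≤ |n * α - γ - z| := nint_le_abs_sub _ _
    _ ≤ |n * (α - p / q)| + |(c - q * γ) / q| := hsplit ▸ abs_add_le _ _
    _ ≤ 2 / q + 1 / q := add_le_add h1 h2
    _ = 3 / q := by ring

theorem Irrational.not_terminatedAt {α : ℝ} (hα : Irrational α) (k : ℕ) :
    ¬(GenContFract.of α).TerminatedAt k := fun h => by
  obtain ⟨q, hq⟩ := (GenContFract.terminates_iff_rat α).1 ⟨k, h⟩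
  exact hα ⟨q, hq.symm⟩

theorem exists_int_contsAux_of (α : ℝ) (k : ℕ) :
    (∃ A : ℤ, ((GenContFract.of α).contsAux k).a = A) ∧
      ∃ B : ℤ, ((GenContFract.of α).contsAux k).b = B := by
  induction k using Nat.strong_induction_on with
  | _ k ih =>
    rcases k with _ | _ | k
    · exact ⟨⟨1, by simp [GenContFract.contsAux]⟩, ⟨0, by simp [GenContFract.contsAux]⟩⟩
    · exact ⟨⟨⌊α⌋, by simp [GenContFract.contsAux]⟩, ⟨1, by simp [GenContFract.contsAux]⟩⟩
    · rcases hs : (GenContFract.of α).s.get? k with _ | gp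
      · rw [GenContFract.contsAux_stable_step_of_terminated hs]
        exact ih (k + 1) (by lia)
      · obtain ⟨ha, z, hb⟩ := GenContFract.of_partNum_eq_one_and_exists_int_partDen_eq hs
        obtain ⟨⟨A, hA⟩, ⟨B, hB⟩⟩ := ih k (by lia)
        obtain ⟨⟨A', hA'⟩, ⟨B', hB'⟩⟩ := ih (k + 1) (by lia)
        rw [GenContFract.contsAux_recurrence hs rfl rfl, ha, hb, hA, hB, hA', hB']
        exact ⟨⟨z * A' + 1 * A, by push_cast; ring⟩, ⟨z * B' + 1 * B, by push_cast; ring⟩⟩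

theorem one_le_contDen {α : ℝ} (hα : Irrational α) (k : ℕ) : 1 ≤ contDen α k := by
  have h := GenContFract.succ_nth_fib_le_of_nth_den (v := α) (n := k)
    (Or.inr (hα.not_terminatedAt _))
  have h1 : (1 : ℝ) ≤ Nat.fib (k + 1) := by exact_mod_cast Nat.fib_pos.2 k.succ_pos
  exact h1.trans h

theorem two_mul_contDen_le {α : ℝ} (hα : Irrational α) (k : ℕ) :
    2 * contDen α k ≤ contDen α (k + 2) := by
  obtain ⟨gp, hs⟩ := Option.ne_none_iff_exists'.1 (hα.not_terminatedAt (k + 1))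
  have ha := (GenContFract.of_partNum_eq_one_and_exists_int_partDen_eq hs).1
  have hb := GenContFract.of_one_le_get?_partDen (GenContFract.partDen_eq_s_b hs)
  have hrec := GenContFract.dens_recurrence hs rfl rfl
  have hmono : contDen α k ≤ contDen α (k + 1) := GenContFract.of_den_mono
  have hpos := one_le_contDen hα (k + 1)
  rw [ha, one_mul] at hrec
  change contDen α (k + 2) = gp.b * contDen α (k + 1) + contDen α k at hrec
  rw [hrec]
  nlinarith

theorem two_pow_mul_contDen_le {α : ℝ} (hα : Irrational α) (k i : ℕ) :
    2 ^ i * contDen α k ≤ contDen α (k + 2 * i) := by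
  induction i with
  | zero => simp
  | succ i ih =>
    calc 2 ^ (i + 1) * contDen α k = 2 * (2 ^ i * contDen α k) := by ring
      _ ≤ 2 * contDen α (k + 2 * i) := by gcongr
      _ ≤ contDen α (k + 2 * (i + 1)) := two_mul_contDen_le hα _

/-- The convergents of an irrational number are given by coprime integers. -/
theorem exists_coprime_contDen {α : ℝ} (hα : Irrational α) (k : ℕ) :
    ∃ (p : ℤ) (q : ℕ), 0 < q ∧ contDen α k = q ∧ IsCoprime p (q : ℤ) ∧
      |α - p / q| ≤ 1 / (q : ℝ) ^ 2 := by
  obtain ⟨⟨A, hA⟩, ⟨B, hB⟩⟩ := exists_int_contsAux_of α (k + 1)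
  obtain ⟨⟨A', hA'⟩, ⟨B', hB'⟩⟩ := exists_int_contsAux_of α (k + 2)
  have hnum : (GenContFract.of α).nums k = A := hA
  have hden : (GenContFract.of α).dens k = B := hB
  have hnum' : (GenContFract.of α).nums (k + 1) = A' := hA'
  have hden' : (GenContFract.of α).dens (k + 1) = B' := hB'
  have h1 : (1 : ℝ) ≤ B := hden ▸ one_le_contDen hα k
  have hmono : (B : ℝ) ≤ B' := by
    rw [← hden, ← hden']
    exact GenContFract.of_den_mono
  have hdet := SimpContFract.determinant (s := SimpContFract.of α) (hα.not_terminatedAt k)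
  have hcoe : ((SimpContFract.of α : SimpContFract ℝ) : GenContFract ℝ) = GenContFract.of α := rfl
  rw [hcoe, hnum, hden, hnum', hden'] at hdet
  have hdet' : A * B' - B * A' = (-1) ^ (k + 1) := by exact_mod_cast hdet
  have happ := GenContFract.abs_sub_convs_le (hα.not_terminatedAt k)
  rw [GenContFract.conv_eq_num_div_den, hnum, hden, hden'] at happ
  have hBpos : 0 < B := by
    have : (0 : ℝ) < B := by linarith
    exact_mod_cast this
  lift B to ℕ using hBpos.le
  push_cast at *
  refine ⟨A, B, by exact_mod_cast hBpos, hden, ?_, happ.trans ?_⟩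
  · refine ⟨(-1) ^ (k + 1) * B', -(-1) ^ (k + 1) * A', ?_⟩
    have hsq : ((-1 : ℤ) ^ (k + 1)) * (-1) ^ (k + 1) = 1 := by
      rw [← mul_pow]; simp
    linear_combination (-1) ^ (k + 1) * hdet' + hsq
  · rw [sq]
    gcongr

/-- Along the continuants `q_k` of `α` there are `n ∈ [q_k, 2 q_k)` with
`‖n α - γ‖ ≤ 3 / q_k`. -/
theorem exists_nat_nint_sub_le_contDen {α : ℝ} (hα : Irrational α) (γ : ℝ) (k : ℕ) :
    ∃ n : ℕ, contDen α k ≤ n ∧ n ≤ 2 * contDen α k ∧ n * nint (n * α - γ) ≤ 6 := by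
  obtain ⟨p, q, hq, hqk, hpq, happ⟩ := exists_coprime_contDen hα k
  obtain ⟨n, h1, h2, h3⟩ := exists_nat_nint_sub_le hq hpq happ γ
  have hq' : (0 : ℝ) < q := by exact_mod_cast hq
  have h2' : (n : ℝ) ≤ 2 * q := by exact_mod_cast h2.le
  refine ⟨n, by rw [hqk]; exact_mod_cast h1, by rw [hqk]; exact h2', ?_⟩
  calc n * nint (n * α - γ) ≤ 2 * q * (3 / q) := mul_le_mul h2' h3 (nint_nonneg _) (by positivity)
    _ = 6 := by field_simp; norm_num

/-- The scale `η = 4 s / 2 ^ s` of the arcs that are hit by `2 ^ s` lacunary dilates. -/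
noncomputable def arcLength (s : ℕ) : ℝ := 4 * s / 2 ^ s

theorem arcLength_pos {s : ℕ} (hs : 5 ≤ s) : 0 < arcLength s := by
  have : (0 : ℝ) < s := by exact_mod_cast (by lia : 0 < s)
  unfold arcLength
  positivity

theorem arcLength_le_one {s : ℕ} (hs : 5 ≤ s) : arcLength s ≤ 1 := by
  unfold arcLength
  rw [div_le_one (by positivity)]
  have : 4 * s ≤ 2 ^ s := by
    induction s, hs using Nat.le_induction with
    | base => norm_num
    | succ s hs ih => rw [pow_succ]; lia
  exact_mod_cast this

/-- The `x` for which some arc of length `arcLength s` contains none of the points `m i * x`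
modulo `1`, `i < 2 ^ s`. -/
def missedArc (m : ℕ → ℝ) (s : ℕ) : Set ℝ :=
  {x | 5 ≤ s ∧ ∃ i : ℕ, i < 2 ^ s ∧ ∀ j < 2 ^ s, arcLength s ≤ Int.fract (m j * x - i * arcLength s)}

theorem volume_missedArc_inter_le {m : ℕ → ℝ} {s : ℕ} (hm : ∀ i, 1 ≤ m i)
    (hgrow : ∀ i, 4 * m i ≤ arcLength s * m (i + 1)) (T : ℕ) :
    volume (missedArc m s ∩ Icc (-T : ℝ) T) ≤
      ENNReal.ofReal ((2 * T + 2) * (1 / 2) ^ s) := by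
  by_cases hs : 5 ≤ s
  swap
  · simp [missedArc, hs]
  have hη := arcLength_pos hs
  have hη1 := arcLength_le_one hs
  set η := arcLength s with hηs
  have hsub : missedArc m s ∩ Icc (-T : ℝ) T ⊆ ⋃ i ∈ Finset.range (2 ^ s),
      {x ∈ Icc (-T : ℝ) T | ∀ j < 2 ^ s, η ≤ Int.fract (m j * x - i * η)} := by
    rintro x ⟨⟨_, i, hi, hx⟩, hxT⟩
    simp only [mem_iUnion]
    exact ⟨i, Finset.mem_range.2 hi, hxT, hx⟩
  have hpow : (1 - η / 2) ^ 2 ^ s ≤ (1 / 4) ^ s := by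
    calc (1 - η / 2) ^ 2 ^ s ≤ (Real.exp (-(η / 2))) ^ 2 ^ s :=
          pow_le_pow_left₀ (by linarith) (by linarith [Real.add_one_le_exp (-(η / 2))]) _
      _ = Real.exp (-2) ^ s := by
          rw [← Real.exp_nat_mul, ← Real.exp_nat_mul, hηs, arcLength]
          congr 1
          push_cast
          field_simp
          norm_num
      _ ≤ (1 / 4) ^ s := by
          refine pow_le_pow_left₀ (Real.exp_pos _).le ?_ _
          have h1 : (2 : ℝ) ≤ Real.exp 1 := by linarith [Real.add_one_le_exp (1 : ℝ)]
          rw [Real.exp_neg, one_div]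
          refine inv_anti₀ (by norm_num) ?_
          calc (4 : ℝ) = 2 * 2 := by norm_num
            _ ≤ Real.exp 1 * Real.exp 1 := by gcongr
            _ = Real.exp 2 := by rw [← Real.exp_add]; norm_num
  have hm0 : 2 / m 0 ≤ 2 := by
    have := hm 0
    exact div_le_self (by norm_num) this
  have hlen : (T - -T + 2 / m 0 : ℝ) ≤ 2 * T + 2 := by linarith
  calc volume (missedArc m s ∩ Icc (-T : ℝ) T)
      ≤ ∑ i ∈ Finset.range (2 ^ s),
        volume {x ∈ Icc (-T : ℝ) T | ∀ j < 2 ^ s, η ≤ Int.fract (m j * x - i * η)} :=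
        (measure_mono hsub).trans (measure_biUnion_finset_le _ _)
    _ ≤ (Finset.range (2 ^ s)).card • ENNReal.ofReal ((1 / 4) ^ s * (2 * T + 2)) := by
        refine Finset.sum_le_card_nsmul _ _ _ fun i _ => ?_
        have hT : (-T : ℝ) ≤ T := by linarith [(Nat.cast_nonneg T : (0 : ℝ) ≤ T)]
        refine (volume_forall_le_fract_le (i * η) hη1 (2 ^ s) m
          (fun i => zero_lt_one.trans_le (hm i)) hgrow _ _ hT).trans ?_
        refine ENNReal.ofReal_le_ofReal (mul_le_mul hpow hlen ?_ (by positivity))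
        have := hm 0
        have : 0 ≤ 2 / m 0 := by positivity
        linarith
    _ = ENNReal.ofReal ((2 * T + 2) * (1 / 2) ^ s) := by
        rw [nsmul_eq_mul, ← ENNReal.ofReal_natCast, ← ENNReal.ofReal_mul (Nat.cast_nonneg _)]
        congr 1
        have : (1 / 4 : ℝ) ^ s = (1 / 2) ^ s * (1 / 2) ^ s := by rw [← mul_pow]; norm_num
        rw [this]
        have h2 : (2 : ℝ) ^ s * (1 / 2) ^ s = 1 := by rw [← mul_pow]; norm_num
        push_cast [Finset.card_range]
        linear_combination ((1 / 2 : ℝ) ^ s * (2 * T + 2)) * h2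

/-- Almost every `x` eventually lies in no `missedArc (m s) s`. -/
theorem ae_eventually_notMem_missedArc {m : ℕ → ℕ → ℝ} (hm : ∀ s i, 1 ≤ m s i)
    (hgrow : ∀ s, 5 ≤ s → ∀ i, 4 * m s i ≤ arcLength s * m s (i + 1)) :
    ∀ᵐ x ∂(volume : Measure ℝ), ∀ᶠ s in Filter.atTop, x ∉ missedArc (m s) s := by
  have hT : ∀ T : ℕ, ∀ᵐ x ∂(volume : Measure ℝ), ∀ᶠ s in Filter.atTop,
      x ∉ missedArc (m s) s ∩ Icc (-T : ℝ) T := by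
    intro T
    refine ae_eventually_notMem (s := fun s => missedArc (m s) s ∩ Icc (-T : ℝ) T)
      (ne_top_of_le_ne_top (b := ∑' s : ℕ, ENNReal.ofReal ((2 * T + 2) * (1 / 2) ^ s)) ?_
        (ENNReal.tsum_le_tsum fun s => ?_))
    · exact (summable_geometric_two.mul_left _).tsum_ofReal_ne_top
    · by_cases hs : 5 ≤ s
      · exact volume_missedArc_inter_le (hm s) (hgrow s hs) T
      · simp [missedArc, hs]
  filter_upwards [ae_all_iff.2 hT] with x hx
  obtain ⟨T, hxT⟩ := exists_nat_ge |x|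
  filter_upwards [hx T] with s hs hmem
  exact hs ⟨hmem, abs_le.1 hxT⟩

/-- Outside `missedArc m s`, every target `δ` is approached to within `arcLength s`. -/
theorem exists_nint_sub_le_of_notMem_missedArc {m : ℕ → ℝ} {s : ℕ} {x : ℝ} (hs : 5 ≤ s)
    (hx : x ∉ missedArc m s) (δ : ℝ) : ∃ j < 2 ^ s, nint (m j * x - δ) ≤ arcLength s := by
  have hη := arcLength_pos hs
  set i : ℕ := ⌊Int.fract δ / arcLength s⌋₊ with hi
  have hfr := Int.fract_nonneg δ
  have hfr1 := Int.fract_lt_one δ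
  have h1 : i * arcLength s ≤ Int.fract δ := by
    rw [← le_div_iff₀ hη]
    exact Nat.floor_le (by positivity)
  have h2 : Int.fract δ < (i + 1) * arcLength s := by
    rw [← div_lt_iff₀ hη]
    exact Nat.lt_floor_add_one _
  have hi2 : i < 2 ^ s := by
    rw [hi, Nat.floor_lt (by positivity), div_lt_iff₀ hη, arcLength]
    have : (5 : ℝ) ≤ s := by exact_mod_cast hs
    push_cast
    rw [mul_div_cancel₀ _ (by positivity)]
    linarith
  have hδ : Int.fract (δ - i * arcLength s) < arcLength s := by
    have hle := arcLength_le_one hs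
    have : Int.fract (δ - i * arcLength s) = Int.fract δ - i * arcLength s := by
      rw [Int.fract_eq_iff]
      refine ⟨by linarith, by linarith, ⌊δ⌋, ?_⟩
      unfold Int.fract
      ring
    rw [this]
    linarith
  simp only [missedArc, mem_ofPred_eq, not_and, not_exists, not_forall, not_le] at hx
  obtain ⟨j, hj, hlt⟩ := hx hs i hi2
  exact ⟨j, hj, nint_sub_le_of_fract_lt hlt hδ⟩

theorem six_mul_arcLength_lt {ε D : ℝ} (hε : 0 < ε) (hD : 0 < D) {s : ℕ} (hs : 5 ≤ s)
    (hsD : 192 * D < s) {y : ℝ} (hy1 : 2 ^ s ≤ y) (hy2 : y ≤ D * (s * 2 ^ s)) :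
    6 * arcLength s < Real.log y ^ ((3 : ℝ) + ε) / y := by
  have hs' : (5 : ℝ) ≤ s := by exact_mod_cast hs
  have h2s : (0 : ℝ) < 2 ^ s := by positivity
  have hy : 0 < y := h2s.trans_le hy1
  have hlog : (s : ℝ) / 2 ≤ Real.log y := by
    calc (s : ℝ) / 2 ≤ s * Real.log 2 := by nlinarith [Real.log_two_gt_d9]
      _ = Real.log (2 ^ s) := by rw [Real.log_pow]
      _ ≤ Real.log y := Real.log_le_log h2s hy1
  have hrpow : ((s : ℝ) / 2) ^ 3 ≤ Real.log y ^ ((3 : ℝ) + ε) := by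
    calc ((s : ℝ) / 2) ^ 3 ≤ Real.log y ^ 3 := by gcongr
      _ = Real.log y ^ (3 : ℝ) := by norm_cast
      _ ≤ Real.log y ^ ((3 : ℝ) + ε) :=
          Real.rpow_le_rpow_of_exponent_le (by linarith) (by linarith)
  rw [lt_div_iff₀ hy]
  refine lt_of_lt_of_le ?_ hrpow
  calc 6 * arcLength s * y ≤ 6 * arcLength s * (D * (s * 2 ^ s)) := by
        have := arcLength_pos hs
        gcongr
    _ = 24 * D * s ^ 2 := by unfold arcLength; field_simp; ring
    _ < ((s : ℝ) / 2) ^ 3 := by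
        have hs2 : (0 : ℝ) < s ^ 2 := by positivity
        have := mul_lt_mul_of_pos_right hsD hs2
        linarith [(by ring : ((s : ℝ) / 2) ^ 3 = s * s ^ 2 / 8)]

theorem littlewood_ae (ε : ℝ) (hε : 0 < ε) (α : ℝ) (hα : memK α) (γ : ℝ) :
    ∀ᵐ β ∂(volume : Measure ℝ), ∀ δ : ℝ,
      Set.Infinite {n : ℕ | 0 < n ∧ (n : ℝ) * nint (n * α - γ) * nint (n * β - δ) <
          Real.log (Real.log n) ^ ((3 : ℝ) + ε) / Real.log n} := by
  obtain ⟨hirr, Λ, hΛ⟩ := hα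
  have hlog : ∀ k : ℕ, 0 < k → Real.log (contDen α k) ≤ max Λ 1 * k := by
    intro k hk
    have h : Real.log (contDen α k) / k ≤ Λ := hΛ ⟨⟨k, hk⟩, rfl⟩
    rw [div_le_iff₀ (by exact_mod_cast hk)] at h
    exact h.trans (by gcongr; exact le_max_left _ _)
  choose f hf1 hf2 hf3 using exists_nat_nint_sub_le_contDen hirr γ
  set m : ℕ → ℕ → ℕ := fun s j => f (4 * s * (2 ^ s + j))
  have hm1 : ∀ s i, (1 : ℝ) ≤ m s i := fun s i => (one_le_contDen hirr _).trans (hf1 _)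
  have hgrow : ∀ s, 5 ≤ s → ∀ i, 4 * (m s i : ℝ) ≤ arcLength s * m s (i + 1) := by
    intro s hs i
    have hs' : (5 : ℝ) ≤ s := by exact_mod_cast hs
    have hη := arcLength_pos hs
    have h := two_pow_mul_contDen_le hirr (4 * s * (2 ^ s + i)) (2 * s)
    rw [show 4 * s * (2 ^ s + i) + 2 * (2 * s) = 4 * s * (2 ^ s + (i + 1)) by ring] at h
    set Q := contDen α (4 * s * (2 ^ s + i))
    have hQ1 : 1 ≤ Q := one_le_contDen hirr _
    have h2s : (1 : ℝ) ≤ 2 ^ s := one_le_pow₀ (by norm_num)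
    calc 4 * (m s i : ℝ) ≤ 4 * (2 * Q) := by gcongr; exact hf2 _
      _ ≤ 4 * s * 2 ^ s * Q := by nlinarith [mul_le_mul hs' h2s zero_le_one (by linarith)]
      _ = arcLength s * (2 ^ (2 * s) * Q) := by
          unfold arcLength
          rw [two_mul, pow_add]
          field_simp
      _ ≤ arcLength s * m s (i + 1) := by gcongr; exact h.trans (hf1 _)
  filter_upwards [ae_eventually_notMem_missedArc (m := fun s i => m s i) hm1 hgrow] with β hβ δ
  refine Set.infinite_of_forall_exists_gt fun N => ?_
  set D : ℝ := 8 * max Λ 1 + 1 with hD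
  have hD0 : 0 < D := by have := le_max_right Λ 1; linarith
  obtain ⟨s, hsβ, hs5, hsD, hsN⟩ := (hβ.and ((Filter.eventually_ge_atTop 5).and
    ((tendsto_natCast_atTop_atTop.eventually_gt_atTop (192 * D)).and
      (Filter.eventually_ge_atTop N)))).exists
  obtain ⟨j, hj, hnear⟩ := exists_nint_sub_le_of_notMem_missedArc hs5 hsβ δ
  have hs' : (5 : ℝ) ≤ s := by exact_mod_cast hs5
  have h2s : (1 : ℝ) ≤ 2 ^ s := one_le_pow₀ (by norm_num)
  have hk : 0 < 4 * s * (2 ^ s + j) := by positivity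
  have hQ1 := one_le_contDen hirr (4 * s * (2 ^ s + j))
  have hmpos : (0 : ℝ) < m s j := zero_lt_one.trans_le (hm1 s j)
  have hlower : (2 : ℝ) ^ s ≤ Real.log (m s j) := by
    have h := two_pow_mul_contDen_le hirr 0 (2 * s * (2 ^ s + j))
    rw [show 0 + 2 * (2 * s * (2 ^ s + j)) = 4 * s * (2 ^ s + j) by ring] at h
    have h1 : (2 : ℝ) ^ (2 * s * (2 ^ s + j)) ≤ m s j :=
      ((le_mul_of_one_le_right (by positivity) (one_le_contDen hirr 0)).trans h).trans (hf1 _)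
    have h2 := Real.log_le_log (by positivity) h1
    rw [Real.log_pow] at h2
    refine le_trans ?_ h2
    push_cast
    have hj0 : (0 : ℝ) ≤ j := j.cast_nonneg
    have h5 : (1 : ℝ) ≤ 2 * s * Real.log 2 := by nlinarith [Real.log_two_gt_d9]
    nlinarith
  have hupper : Real.log (m s j) ≤ D * (s * 2 ^ s) := by
    have h1 : Real.log (m s j) ≤ Real.log 2 + Real.log (contDen α (4 * s * (2 ^ s + j))) := by
      rw [← Real.log_mul (by norm_num) (by positivity)]
      exact Real.log_le_log hmpos (hf2 _)
    have h2 := hlog _ hk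
    have hj' : (j : ℝ) ≤ 2 ^ s := by exact_mod_cast hj.le
    have hΛ1 : (1 : ℝ) ≤ max Λ 1 := le_max_right _ _
    have h3 : max Λ 1 * ((4 * s * (2 ^ s + j) : ℕ) : ℝ) ≤ max Λ 1 * (4 * s * (2 ^ s + 2 ^ s)) := by
      push_cast
      gcongr
    have h4 : Real.log 2 ≤ s * 2 ^ s := by nlinarith [Real.log_two_lt_d9]
    calc Real.log (m s j) ≤ s * 2 ^ s + max Λ 1 * (4 * s * (2 ^ s + 2 ^ s)) := by linarith
      _ = D * (s * 2 ^ s) := by rw [hD]; ring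
  refine ⟨m s j, ⟨by exact_mod_cast hmpos, ?_⟩, ?_⟩
  · refine lt_of_le_of_lt ?_ (six_mul_arcLength_lt hε hD0 hs5 hsD hlower hupper)
    exact mul_le_mul (hf3 _) hnear (nint_nonneg _) (by norm_num)
  · have h1 : (s : ℝ) < 2 ^ s := by exact_mod_cast Nat.lt_two_pow_self
    have h2 : (s : ℝ) < m s j := by linarith [Real.log_le_self hmpos.le]
    exact hsN.trans_lt (by exact_mod_cast h2)
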